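/- Singular value bounds for solutions of Sylvester equations with spectra in opposite real intervals: Let 0 < a < b be real numbers and let μ₂ = exp(π² / log(4b/a)). Let X ∈ ℂ^{m×n} (m ≥ n) satisfy AX − XB = F, where A and B are normal matrices with all eigenvalues of A in [−b, −a] and all eigenvalues of B in [a, b]. Suppose that for some constant K ≥ 1 and all 0 ≤ j < n, σ_{j+1}(F) ≤ K μ₂^{−j} ‖F‖₂. Then for every triangular number t = k(k+1)/2 with 1 ≤ t < n, σ_{t+1}(X) ≤ (K b / a) · (6√t + 1) · μ₂^{−(√(8t+1) − 1)/2} · ‖X‖₂. -/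

import Mathlib

/-- The spectral norm of a complex matrix. -/
noncomputable def specNorm {m n : ℕ} (M : Matrix (Fin m) (Fin n) ℂ) : ℝ :=
  ‖LinearMap.toContinuousLinearMap (Matrix.toEuclideanLin M)‖

/-- The `j`-th largest singular value of a complex matrix (for `j ≥ 1`), via the
Eckart–Young characterization `σ_j(M) = min {‖M - N‖₂ : rank N < j}`. -/
noncomputable def singularValue {m n : ℕ} (M : Matrix (Fin m) (Fin n) ℂ) (j : ℕ) : ℝ :=
  sInf ((fun N : Matrix (Fin m) (Fin n) ℂ => specNorm (M - N)) '' {N | N.rank < j})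

section Theta

open Filter Topology

/-- The product `∏_{j < m} (1 - q^{2j+2})`. -/
noncomputable def evenPochhammer (q : ℝ) (m : ℕ) : ℝ :=
  ∏ j ∈ Finset.range m, (1 - q ^ (2 * j + 2))

/-- The reciprocal of `evenPochhammer`, extended by zero to negative integers. -/
noncomputable def invEvenPochhammer (q : ℝ) (m : ℤ) : ℝ :=
  if m < 0 then 0 else (evenPochhammer q m.toNat)⁻¹

lemma evenPochhammer_pos {q : ℝ} (hq0 : 0 < q) (hq1 : q < 1) (m : ℕ) :
    0 < evenPochhammer q m :=
  Finset.prod_pos fun j _ => sub_pos.2 (pow_lt_one₀ hq0.le hq1 (by omega))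

lemma evenPochhammer_succ (q : ℝ) (m : ℕ) :
    evenPochhammer q (m + 1) = evenPochhammer q m * (1 - q ^ (2 * m + 2)) :=
  Finset.prod_range_succ _ _

lemma exp_zpow (x : ℝ) (n : ℤ) : Real.exp x ^ n = Real.exp (n * x) := by
  rw [← Real.rpow_intCast, ← Real.exp_mul, mul_comm]

lemma evenPochhammer_antitone {q : ℝ} (hq0 : 0 < q) (hq1 : q < 1) :
    Antitone (evenPochhammer q) := by
  refine antitone_nat_of_succ_le fun m => ?_
  rw [evenPochhammer_succ]
  exact mul_le_of_le_one_right (evenPochhammer_pos hq0 hq1 m).le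
    (sub_le_self _ (pow_nonneg hq0.le _))

lemma exists_tendsto_evenPochhammer {q : ℝ} (hq0 : 0 < q) (hq1 : q < 1) :
    ∃ L > 0, Tendsto (evenPochhammer q) atTop (𝓝 L) := by
  have hs : Summable fun j : ℕ => -q ^ (2 * j + 2) := by
    have h : Summable fun j : ℕ => q ^ 2 * (q ^ 2) ^ j :=
      (summable_geometric_of_lt_one (sq_nonneg q) (by nlinarith)).mul_left _
    refine h.neg.congr fun j => ?_
    ring
  have hl := (Real.summable_log_one_add_of_summable hs).hasSum.tendsto_sum_nat
  refine ⟨_, Real.exp_pos _, ((Real.continuous_exp.tendsto _).comp hl).congr fun m => ?_⟩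
  rw [Function.comp_apply, Real.exp_sum, evenPochhammer]
  refine Finset.prod_congr rfl fun j _ => ?_
  rw [Real.exp_log, sub_eq_add_neg]
  linarith [pow_lt_one₀ hq0.le hq1 (show 2 * j + 2 ≠ 0 by omega)]

lemma invEvenPochhammer_sub_one {q : ℝ} (hq0 : 0 < q) (hq1 : q < 1) (m : ℤ) :
    invEvenPochhammer q (m - 1) = (1 - q ^ (2 * m)) * invEvenPochhammer q m := by
  rcases lt_trichotomy m 0 with h | rfl | h
  · simp [invEvenPochhammer, h, show m - 1 < 0 by omega]
  · simp [invEvenPochhammer]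
  · obtain ⟨k, rfl⟩ : ∃ k : ℕ, m = k + 1 := ⟨(m - 1).toNat, by omega⟩
    have h1 : ¬ ((k : ℤ) + 1 < 0) := by omega
    have h2 : ((k : ℤ) + 1).toNat = k + 1 := by omega
    have h3 : q ^ (2 * ((k : ℤ) + 1)) = q ^ (2 * k + 2) := by
      rw [← zpow_natCast]; congr 1
    have hp := (evenPochhammer_pos hq0 hq1 (k + 1)).ne'
    rw [evenPochhammer_succ] at hp
    simp only [invEvenPochhammer, h1, h2, h3, if_false, add_sub_cancel_right, Int.toNat_natCast]
    rw [if_neg (by omega), evenPochhammer_succ]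
    have := left_ne_zero_of_mul hp
    have := right_ne_zero_of_mul hp
    field_simp

/-- The coefficients of the finite Jacobi triple product, up to a common factor. -/
noncomputable def tripleCoeff (q : ℝ) (N : ℕ) (n : ℤ) : ℝ :=
  q ^ (n ^ 2) * invEvenPochhammer q (N - n) * invEvenPochhammer q (N + n)

lemma tripleCoeff_succ {q : ℝ} (hq0 : 0 < q) (hq1 : q < 1) (N : ℕ) (n : ℤ) :
    (1 + q ^ (4 * N + 2)) * tripleCoeff q N n +
        q ^ (2 * N + 1) * (tripleCoeff q N (n - 1) + tripleCoeff q N (n + 1)) =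
      (1 - q ^ (4 * N + 2)) * (1 - q ^ (4 * N + 4)) * tripleCoeff q (N + 1) n := by
  have hq := hq0.ne'
  have e1 := invEvenPochhammer_sub_one hq0 hq1 ((N : ℤ) + 1 - n)
  have e2 := invEvenPochhammer_sub_one hq0 hq1 ((N : ℤ) + 1 + n)
  have e3 := invEvenPochhammer_sub_one hq0 hq1 ((N : ℤ) - n)
  have e4 := invEvenPochhammer_sub_one hq0 hq1 ((N : ℤ) + n)
  rw [show (N : ℤ) + 1 - n - 1 = N - n by ring] at e1
  rw [show (N : ℤ) + 1 + n - 1 = N + n by ring] at e2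
  simp only [tripleCoeff]
  rw [show (N : ℤ) - (n - 1) = N + 1 - n by ring, show (N : ℤ) + (n - 1) = N + n - 1 by ring,
    show (N : ℤ) - (n + 1) = N - n - 1 by ring, show (N : ℤ) + (n + 1) = N + 1 + n by ring,
    e3, e4, e1, e2]
  push_cast
  have p1 : q ^ ((n - 1) ^ 2) = q ^ (n ^ 2) * (q ^ n)⁻¹ ^ 2 * q := by
    rw [show (n - 1) ^ 2 = n ^ 2 + (-n) + (-n) + 1 by ring, zpow_add₀ hq, zpow_add₀ hq,
      zpow_add₀ hq, zpow_neg, zpow_one]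
    ring
  have p2 : q ^ ((n + 1) ^ 2) = q ^ (n ^ 2) * (q ^ n) ^ 2 * q := by
    rw [show (n + 1) ^ 2 = n ^ 2 + n + n + 1 by ring, zpow_add₀ hq, zpow_add₀ hq,
      zpow_add₀ hq, zpow_one]
    ring
  have two (m : ℤ) : q ^ (2 * m) = (q ^ m) ^ 2 := by rw [two_mul, zpow_add₀ hq, sq]
  rw [p1, p2, two, two, two, two]
  simp only [zpow_sub₀ hq, zpow_add₀ hq, zpow_natCast, zpow_one]
  have hn : q ^ n ≠ 0 := zpow_ne_zero _ hq
  rw [show q ^ (4 * N + 2) = (q ^ N) ^ 4 * q ^ 2 by ring,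
    show q ^ (4 * N + 4) = (q ^ N) ^ 4 * q ^ 4 by ring,
    show q ^ (2 * N + 1) = (q ^ N) ^ 2 * q by ring]
  field_simp
  ring

lemma tripleCoeff_eq_zero (q : ℝ) (N : ℕ) (n : ℤ) (hn : n ∉ Finset.Icc (-(N : ℤ)) N) :
    tripleCoeff q N n = 0 := by
  rw [Finset.mem_Icc, not_and_or] at hn
  rcases hn with h | h
  · simp [tripleCoeff, invEvenPochhammer, show (N : ℤ) + n < 0 by omega]
  · simp [tripleCoeff, invEvenPochhammer, show (N : ℤ) < n by omega]

lemma summable_tripleCoeff (q z : ℝ) (N : ℕ) : Summable fun n : ℤ => tripleCoeff q N n * z ^ n :=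
  summable_of_ne_finset_zero (s := Finset.Icc (-(N : ℤ)) N) fun n hn => by
    rw [tripleCoeff_eq_zero q N n hn, zero_mul]

/-- The finite Jacobi triple product identity. -/
lemma finite_triple_product {q : ℝ} (hq0 : 0 < q) (hq1 : q < 1) {z : ℝ} (hz : z ≠ 0) (N : ℕ) :
    ∏ j ∈ Finset.range N, (1 + q ^ (2 * j + 1) * z) * (1 + q ^ (2 * j + 1) * z⁻¹) =
      evenPochhammer q (2 * N) * ∑' n : ℤ, tripleCoeff q N n * z ^ n := by
  induction N with
  | zero =>
    rw [tsum_eq_single 0 fun n hn => by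
      rw [tripleCoeff_eq_zero q 0 n (by simpa using hn), zero_mul]]
    simp [tripleCoeff, invEvenPochhammer, evenPochhammer]
  | succ N ih =>
    rw [Finset.prod_range_succ, ih]
    have hS := summable_tripleCoeff q z N
    have h1 : ∑' n : ℤ, tripleCoeff q N (n - 1) * z ^ n =
        z * ∑' n : ℤ, tripleCoeff q N n * z ^ n := by
      rw [← (Equiv.subRight (1 : ℤ)).tsum_eq fun n => tripleCoeff q N n * z ^ n, ← tsum_mul_left]
      refine tsum_congr fun n => ?_
      rw [Equiv.subRight_apply, zpow_sub_one₀ hz]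
      field_simp
    have h2 : ∑' n : ℤ, tripleCoeff q N (n + 1) * z ^ n =
        z⁻¹ * ∑' n : ℤ, tripleCoeff q N n * z ^ n := by
      rw [← (Equiv.addRight (1 : ℤ)).tsum_eq fun n => tripleCoeff q N n * z ^ n, ← tsum_mul_left]
      refine tsum_congr fun n => ?_
      rw [Equiv.coe_addRight, zpow_add_one₀ hz]
      field_simp
    have s1 : Summable fun n : ℤ => tripleCoeff q N (n - 1) * z ^ n := by
      refine (((Equiv.subRight (1 : ℤ)).summable_iff.2 hS).mul_left z).congr fun n => ?_
      rw [Function.comp_apply, Equiv.subRight_apply, zpow_sub_one₀ hz]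
      field_simp
    have s2 : Summable fun n : ℤ => tripleCoeff q N (n + 1) * z ^ n := by
      refine (((Equiv.addRight (1 : ℤ)).summable_iff.2 hS).mul_left z⁻¹).congr fun n => ?_
      rw [Function.comp_apply, Equiv.coe_addRight, zpow_add_one₀ hz]
      field_simp
    have h3 : (1 - q ^ (4 * N + 2)) * (1 - q ^ (4 * N + 4)) *
        ∑' n : ℤ, tripleCoeff q (N + 1) n * z ^ n =
        (1 + q ^ (4 * N + 2)) * ∑' n : ℤ, tripleCoeff q N n * z ^ n + q ^ (2 * N + 1) *
          (z * (∑' n : ℤ, tripleCoeff q N n * z ^ n) +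
            z⁻¹ * ∑' n : ℤ, tripleCoeff q N n * z ^ n) := by
      rw [← h1, ← h2, ← s1.tsum_add s2, ← tsum_mul_left, ← tsum_mul_left, ← tsum_mul_left,
        ← (hS.mul_left _).tsum_add ((s1.add s2).mul_left _)]
      refine tsum_congr fun n => ?_
      rw [← mul_assoc, ← tripleCoeff_succ hq0 hq1]
      ring
    rw [show 2 * (N + 1) = 2 * N + 1 + 1 by ring, evenPochhammer_succ, evenPochhammer_succ,
      show 2 * (2 * N) + 2 = 4 * N + 2 by ring, show 2 * (2 * N + 1) + 2 = 4 * N + 4 by ring]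
    linear_combination (-evenPochhammer q (2 * N)) * h3 + evenPochhammer q (2 * N) *
      (∑' n : ℤ, tripleCoeff q N n * z ^ n) * q ^ (4 * N + 2) * mul_inv_cancel₀ hz

lemma invEvenPochhammer_nonneg {q : ℝ} (hq0 : 0 < q) (hq1 : q < 1) (m : ℤ) :
    0 ≤ invEvenPochhammer q m := by
  unfold invEvenPochhammer
  split_ifs
  exacts [le_rfl, (inv_pos.2 (evenPochhammer_pos hq0 hq1 _)).le]

lemma summable_gaussian (s w : ℝ) (hs : 0 < s) :
    Summable fun n : ℤ => Real.exp (-s * n ^ 2 + n * w) := by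
  have h := (summable_jacobiTheta₂_term_iff (-(w / (2 * Real.pi) : ℝ) * Complex.I)
    ((s / Real.pi : ℝ) * Complex.I)).2 (by simpa using div_pos hs Real.pi_pos)
  refine h.norm.congr fun n => ?_
  rw [norm_jacobiTheta₂_term]
  congr 1
  have := Real.pi_ne_zero
  simp only [Complex.mul_im, Complex.ofReal_re, Complex.I_im, Complex.neg_re, Complex.neg_im,
    Complex.ofReal_im, Complex.I_re]
  field_simp
  ring

/-- The theta series `∑ σⁿ exp(-s n² + n w)`. -/
noncomputable def signedTheta (σ s w : ℝ) : ℝ :=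
  ∑' n : ℤ, σ ^ n * Real.exp (-s * n ^ 2 + n * w)

/-- The Jacobi triple product, up to a factor depending only on `s`. -/
lemma exists_tendsto_triple_product (s : ℝ) (hs : 0 < s) :
    ∃ c > 0, ∀ σ w : ℝ, |σ| = 1 → Tendsto (fun N : ℕ => ∏ j ∈ Finset.range N,
      (1 + σ * Real.exp (w - (2 * j + 1) * s)) * (1 + σ * Real.exp (-w - (2 * j + 1) * s)))
      atTop (𝓝 (c * signedTheta σ s w)) := by
  set q := Real.exp (-s) with hq
  have hq0 : 0 < q := Real.exp_pos _
  have hq1 : q < 1 := by rw [hq, Real.exp_lt_one_iff]; linarith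
  obtain ⟨L, hL, hlim⟩ := exists_tendsto_evenPochhammer hq0 hq1
  have hLle (m : ℕ) : L ≤ evenPochhammer q m :=
    (evenPochhammer_antitone hq0 hq1).le_of_tendsto hlim m
  have hinv_le (m : ℤ) : invEvenPochhammer q m ≤ L⁻¹ := by
    unfold invEvenPochhammer
    split_ifs
    exacts [(inv_pos.2 hL).le, inv_anti₀ hL (hLle _)]
  have hinv_lim (f : ℕ → ℤ) (hf : Tendsto f atTop atTop) :
      Tendsto (fun N => invEvenPochhammer q (f N)) atTop (𝓝 L⁻¹) := by
    have h1 : Tendsto (fun N => (f N).toNat) atTop atTop :=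
      (tendsto_atTop_atTop.2 fun b => ⟨b, fun a ha => by omega⟩ :
        Tendsto Int.toNat atTop atTop).comp hf
    refine ((hlim.comp h1).inv₀ hL.ne').congr' ?_
    filter_upwards [hf.eventually_ge_atTop 0] with N hN
    simp [invEvenPochhammer, not_lt.2 hN]
  have hqz (n : ℤ) : q ^ (n ^ 2) = Real.exp (-s * n ^ 2) := by
    rw [hq, exp_zpow]; push_cast; ring_nf
  refine ⟨L⁻¹, inv_pos.2 hL, fun σ w hσ => ?_⟩
  have hσ0 : σ ≠ 0 := by rintro rfl; simp at hσ
  have hσi : σ⁻¹ = σ := by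
    rcases (abs_eq zero_le_one).1 hσ with rfl | rfl <;> norm_num
  set z := σ * Real.exp w with hz
  have hz0 : z ≠ 0 := mul_ne_zero hσ0 (Real.exp_pos _).ne'
  have hzn (n : ℤ) : z ^ n = σ ^ n * Real.exp (n * w) := by
    rw [hz, mul_zpow, exp_zpow]
  have key : Tendsto (fun N : ℕ => ∑' n : ℤ, tripleCoeff q N n * z ^ n) atTop
      (𝓝 (∑' n : ℤ, L⁻¹ * L⁻¹ * (σ ^ n * Real.exp (-s * n ^ 2 + n * w)))) := by
    refine tendsto_tsum_of_dominated_convergence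
      (bound := fun n : ℤ => L⁻¹ * L⁻¹ * Real.exp (-s * n ^ 2 + n * w))
      ((summable_gaussian s w hs).mul_left _) (fun n => ?_) (Eventually.of_forall fun N n => ?_)
    · have h1 := hinv_lim (fun N => (N : ℤ) - n)
        (tendsto_atTop_add_const_right _ (-n) tendsto_natCast_atTop_atTop)
      have h2 := hinv_lim (fun N => (N : ℤ) + n)
        (tendsto_atTop_add_const_right _ n tendsto_natCast_atTop_atTop)
      have h3 := ((h1.mul h2).const_mul (q ^ (n ^ 2))).mul_const (z ^ n)
      refine (h3.congr fun N => ?_).trans_eq ?_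
      · rw [tripleCoeff, ← mul_assoc (q ^ (n ^ 2))]
      · rw [hqz, hzn, Real.exp_add]; ring_nf
    · rw [norm_mul, hzn, norm_mul, norm_zpow, Real.norm_eq_abs σ, hσ, one_zpow, one_mul,
        Real.exp_add, tripleCoeff, hqz, Real.norm_of_nonneg (Real.exp_pos _).le,
        Real.norm_of_nonneg (mul_nonneg (mul_nonneg (Real.exp_pos _).le
          (invEvenPochhammer_nonneg hq0 hq1 _)) (invEvenPochhammer_nonneg hq0 hq1 _)),
        ← mul_assoc, mul_assoc (Real.exp _), mul_comm (Real.exp _) (_ * _)]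
      gcongr
      · exact invEvenPochhammer_nonneg hq0 hq1 _
      · exact hinv_le _
      · exact hinv_le _
  have h2N : Tendsto (fun N : ℕ => evenPochhammer q (2 * N)) atTop (𝓝 L) :=
    hlim.comp (tendsto_id.const_mul_atTop' two_pos)
  refine ((h2N.mul key).congr fun N => ?_).trans_eq ?_
  · rw [← finite_triple_product hq0 hq1 hz0]
    refine Finset.prod_congr rfl fun j _ => ?_
    have hqj : q ^ (2 * j + 1) = Real.exp (-((2 * j + 1) * s)) := by
      rw [hq, ← Real.exp_nat_mul]; push_cast; ring_nf
    rw [hz, mul_inv, hσi, hqj, ← Real.exp_neg, sub_eq_add_neg, sub_eq_add_neg, Real.exp_add,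
      Real.exp_add]
    ring
  · rw [tsum_mul_left, ← signedTheta]
    field_simp

lemma tsum_int_even_add_odd {f : ℤ → ℝ} (hf : Summable f) :
    ∑' n, f n = ∑' n, f (2 * n) + ∑' n, f (2 * n + 1) := by
  have i1 : Function.Injective fun n : ℤ => 2 * n := fun a b h => by simpa using h
  have i2 : Function.Injective fun n : ℤ => 2 * n + 1 := fun a b h => by simpa using h
  have h1 := (hf.comp_injective i1).hasSum
  have h2 := (hf.comp_injective i2).hasSum
  rw [← i1.hasSum_range_iff] at h1
  rw [← i2.hasSum_range_iff] at h2
  refine (h1.add_isCompl ?_ h2).tsum_eq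
  have e1 : Set.range (fun n : ℤ => 2 * n) = {n | Even n} := by
    ext n; simp [even_iff_exists_two_mul]
  have e2 : Set.range (fun n : ℤ => 2 * n + 1) = {n | Odd n} := by
    ext n; simp [Odd]
  rw [e1, e2]
  exact Int.isCompl_even_odd

lemma norm_signedTheta_term {σ : ℝ} (hσ : |σ| = 1) (s w : ℝ) (n : ℤ) :
    ‖σ ^ n * Real.exp (-s * n ^ 2 + n * w)‖ = Real.exp (-s * n ^ 2 + n * w) := by
  rw [norm_mul, norm_zpow, Real.norm_eq_abs σ, hσ, one_zpow, one_mul,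
    Real.norm_of_nonneg (Real.exp_pos _).le]

/-- The even part of a theta series, `∑ exp(-s (2n)² / 2 + 2 n w)`. -/
noncomputable def evenTheta (s w : ℝ) : ℝ :=
  ∑' n : ℤ, Real.exp (-s * (2 * n) ^ 2 / 2 + 2 * n * w)

/-- The odd part of a theta series, `∑ exp(-s (2n + 1)² / 2 + (2n + 1) w)`. -/
noncomputable def oddTheta (s w : ℝ) : ℝ :=
  ∑' n : ℤ, Real.exp (-s * (2 * n + 1) ^ 2 / 2 + (2 * n + 1) * w)

lemma evenTheta_eq (s w : ℝ) : evenTheta s w = signedTheta 1 (2 * s) (2 * w) := by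
  refine tsum_congr fun n => ?_
  rw [one_zpow, one_mul]; ring_nf

lemma oddTheta_eq (s w : ℝ) :
    oddTheta s w = Real.exp (w - s / 2) * signedTheta 1 (2 * s) (2 * w - 2 * s) := by
  rw [signedTheta, ← tsum_mul_left]
  refine tsum_congr fun n => ?_
  rw [one_zpow, one_mul, ← Real.exp_add]; ring_nf

/-- The addition formula for theta series. -/
lemma signedTheta_mul_signedTheta {σ s : ℝ} (hσ : |σ| = 1) (hs : 0 < s) (w v : ℝ) :
    signedTheta σ s (w + v) * signedTheta σ s (w - v) =
      evenTheta s w * evenTheta s v + σ * (oddTheta s w * oddTheta s v) := by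
  set f : ℝ → ℤ → ℝ := fun w n => σ ^ n * Real.exp (-s * n ^ 2 + n * w) with hf
  have hn (w : ℝ) : Summable fun n => ‖f w n‖ :=
    (summable_gaussian s w hs).congr fun n => (norm_signedTheta_term hσ s w n).symm
  have hprod := summable_mul_of_summable_norm (hn (w + v)) (hn (w - v))
  let e : ℤ × ℤ ≃ ℤ × ℤ :=
    { toFun := fun p => (p.2, p.2 - p.1)
      invFun := fun p => (p.1 - p.2, p.1)
      left_inv := fun p => by simp
      right_inv := fun p => by simp }
  have hσ0 : σ ≠ 0 := by rintro rfl; simp at hσ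
  have hσ2 : σ ^ (2 : ℤ) = 1 := by
    rcases (abs_eq zero_le_one).1 hσ with rfl | rfl <;> norm_num
  have hpe := e.summable_iff.2 hprod
  have hd : Summable fun d : ℤ => ∑' m : ℤ, f (w + v) m * f (w - v) (m - d) := hpe.prod
  have h0 : signedTheta σ s (w + v) * signedTheta σ s (w - v) =
      ∑' d : ℤ, ∑' m : ℤ, f (w + v) m * f (w - v) (m - d) := by
    rw [signedTheta, signedTheta, tsum_mul_tsum_of_summable_norm (hn (w + v)) (hn (w - v)),
      ← e.tsum_eq]
    exact hpe.tsum_prod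
  rw [h0, tsum_int_even_add_odd hd]
  congr 1
  · rw [mul_comm, evenTheta, ← tsum_mul_right]
    refine tsum_congr fun d => ?_
    rw [evenTheta, ← tsum_mul_left, ← (Equiv.addRight d).tsum_eq]
    refine tsum_congr fun c => ?_
    have : σ ^ (c + d) * σ ^ (c + d - 2 * d) = 1 := by
      rw [← zpow_add₀ hσ0, show c + d + (c + d - 2 * d) = 2 * c by ring, zpow_mul, hσ2, one_zpow]
    simp only [hf, Equiv.coe_addRight]
    rw [mul_mul_mul_comm, this, one_mul, ← Real.exp_add, ← Real.exp_add]
    push_cast; ring_nf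
  · rw [mul_comm (oddTheta s w), oddTheta, ← tsum_mul_right, ← tsum_mul_left]
    refine tsum_congr fun d => ?_
    rw [oddTheta, ← tsum_mul_left, ← tsum_mul_left, ← (Equiv.addRight (d + 1)).tsum_eq]
    refine tsum_congr fun c => ?_
    have : σ ^ (c + (d + 1)) * σ ^ (c + (d + 1) - (2 * d + 1)) = σ := by
      rw [← zpow_add₀ hσ0, show c + (d + 1) + (c + (d + 1) - (2 * d + 1)) = 2 * c + 1 by ring,
        zpow_add₀ hσ0, zpow_mul, hσ2, one_zpow, one_mul, zpow_one]
    simp only [hf, Equiv.coe_addRight]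
    rw [mul_mul_mul_comm, this, ← Real.exp_add, ← Real.exp_add]
    push_cast; ring_nf

lemma signedTheta_one_pos {s : ℝ} (hs : 0 < s) (w : ℝ) : 0 < signedTheta 1 s w := by
  have h := summable_gaussian s w hs
  simp only [signedTheta, one_zpow, one_mul]
  exact h.tsum_pos (fun _ => (Real.exp_pos _).le) 0 (Real.exp_pos _)

lemma continuous_signedTheta_one {s : ℝ} (hs : 0 < s) : Continuous (signedTheta 1 s) := by
  have h (w : ℝ) : signedTheta 1 s w = (jacobiTheta₂ (-(w / (2 * Real.pi) : ℝ) * Complex.I)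
      ((s / Real.pi : ℝ) * Complex.I)).re := by
    have : ((signedTheta 1 s w : ℝ) : ℂ) = jacobiTheta₂ (-(w / (2 * Real.pi) : ℝ) * Complex.I)
        ((s / Real.pi : ℝ) * Complex.I) := by
      rw [signedTheta, Complex.ofReal_tsum, jacobiTheta₂]
      refine tsum_congr fun n => ?_
      have hpi : (Real.pi : ℂ) ≠ 0 := by exact_mod_cast Real.pi_ne_zero
      rw [one_zpow, one_mul, jacobiTheta₂_term, Complex.ofReal_exp]
      congr 1
      push_cast
      field_simp
      ring_nf
      rw [Complex.I_sq]
      ring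
    rw [← this, Complex.ofReal_re]
  have hc : Continuous fun w : ℝ => jacobiTheta₂ (-(w / (2 * Real.pi) : ℝ) * Complex.I)
      ((s / Real.pi : ℝ) * Complex.I) := by
    have hd : Continuous fun z : ℂ => jacobiTheta₂ z ((s / Real.pi : ℝ) * Complex.I) :=
      continuous_iff_continuousAt.2 fun z =>
        (differentiableAt_jacobiTheta₂_fst z (by simpa using div_pos hs Real.pi_pos)).continuousAt
    exact hd.comp (by fun_prop)
  rw [funext h]
  exact Complex.continuous_re.comp hc

lemma tsum_half_gaussian_le {r : ℝ} (hr : 0 < r) :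
    ∑' n : ℤ, Real.exp (-r * (n ^ 2 + n)) ≤ 2 * ∑' n : ℤ, Real.exp (-r * n ^ 2) := by
  have h0 : Summable fun n : ℤ => Real.exp (-r * n ^ 2) := by
    simpa using summable_gaussian r 0 hr
  have h1 : Summable fun n : ℤ => Real.exp (-r * (n + 1 : ℤ) ^ 2) :=
    (Equiv.addRight (1 : ℤ)).summable_iff.2 h0
  have h2 : ∑' n : ℤ, Real.exp (-r * (n + 1 : ℤ) ^ 2) = ∑' n : ℤ, Real.exp (-r * n ^ 2) :=
    (Equiv.addRight (1 : ℤ)).tsum_eq fun n : ℤ => Real.exp (-r * n ^ 2)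
  have h3 : Summable fun n : ℤ => Real.exp (-r * (n ^ 2 + n)) :=
    (summable_gaussian r (-r) hr).congr fun n => by ring_nf
  rw [two_mul]
  nth_rewrite 2 [← h2]
  rw [← h0.tsum_add h1]
  refine h3.tsum_le_tsum (fun n => ?_) (h0.add h1)
  rcases le_or_gt 0 n with h | h
  · refine le_add_of_le_of_nonneg (Real.exp_le_exp.2 ?_) (Real.exp_pos _).le
    have : (0 : ℝ) ≤ n := by exact_mod_cast h
    nlinarith
  · refine le_add_of_nonneg_of_le (Real.exp_pos _).le (Real.exp_le_exp.2 ?_)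
    have : (n : ℝ) + 1 ≤ 0 := by exact_mod_cast h
    push_cast
    nlinarith

/-- Poisson summation bounds the alternating theta constant by the plain one. -/
lemma signedTheta_neg_one_le {s : ℝ} (hs : 0 < s) :
    |signedTheta (-1) s 0| ≤ 2 * Real.exp (-(Real.pi ^ 2 / (4 * s))) * signedTheta 1 s 0 := by
  have hpi := Real.pi_pos
  set a := s / Real.pi with ha
  have ha0 : 0 < a := div_pos hs hpi
  have hsa : s = Real.pi * a := by rw [ha]; field_simp
  have e1 : signedTheta 1 s 0 =
      1 / a ^ (1 / 2 : ℝ) * ∑' n : ℤ, Real.exp (-Real.pi / a * n ^ 2) := by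
    rw [← Real.tsum_exp_neg_mul_int_sq ha0, signedTheta]
    refine tsum_congr fun n => ?_
    rw [one_zpow, one_mul, hsa]; ring_nf
  have e2 : signedTheta (-1) s 0 =
      1 / a ^ (1 / 2 : ℝ) * ∑' n : ℤ, Real.exp (-Real.pi / a * (n - 1 / 2) ^ 2) := by
    have h := Complex.tsum_exp_neg_quadratic (a := a) (by simpa using ha0) (Complex.I / 2)
    have hI (n : ℤ) : (n : ℂ) + Complex.I * (Complex.I / 2) = ((n - 1 / 2 : ℝ) : ℂ) := by
      rw [← mul_div_assoc, Complex.I_mul_I]; push_cast; ring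
    have hL (n : ℤ) : Complex.exp (-Real.pi * a * n ^ 2 + 2 * Real.pi * (Complex.I / 2) * n) =
        (((-1 : ℝ) ^ n * Real.exp (-s * n ^ 2 + n * 0) : ℝ) : ℂ) := by
      rw [Complex.exp_add, show 2 * Real.pi * (Complex.I / 2) * n = n * (Real.pi * Complex.I) by ring,
        Complex.exp_int_mul, Complex.exp_pi_mul_I, hsa]
      push_cast
      rw [mul_comm]
      ring_nf
    simp only [hI, hL] at h
    rw [← Complex.ofReal_inj, signedTheta, Complex.ofReal_tsum, h]
    push_cast [Complex.ofReal_cpow ha0.le]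
    rfl
  have e3 : ∑' n : ℤ, Real.exp (-Real.pi / a * (n - 1 / 2) ^ 2) =
      Real.exp (-(Real.pi ^ 2 / (4 * s))) * ∑' n : ℤ, Real.exp (-(Real.pi / a) * (n ^ 2 + n)) := by
    rw [← (Equiv.addRight (1 : ℤ)).tsum_eq, ← tsum_mul_left]
    refine tsum_congr fun n => ?_
    rw [← Real.exp_add, hsa, Equiv.coe_addRight]
    congr 1
    push_cast
    field_simp
    ring
  rw [e1, e2, e3, abs_of_nonneg (mul_nonneg (by positivity) (mul_nonneg (Real.exp_pos _).le
    (tsum_nonneg fun _ => (Real.exp_pos _).le)))]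
  have h := tsum_half_gaussian_le (div_pos hpi ha0)
  rw [neg_div]
  calc _ = 1 / a ^ (1 / 2 : ℝ) * Real.exp (-(Real.pi ^ 2 / (4 * s))) *
        ∑' n : ℤ, Real.exp (-(Real.pi / a) * (n ^ 2 + n)) := by ring
    _ ≤ 1 / a ^ (1 / 2 : ℝ) * Real.exp (-(Real.pi ^ 2 / (4 * s))) *
        (2 * ∑' n : ℤ, Real.exp (-(Real.pi / a) * n ^ 2)) := by gcongr
    _ = _ := by ring

/-- The absolute value of `tanh (x / 2)`. -/
noncomputable def absTanhHalf (x : ℝ) : ℝ := |1 - Real.exp x| / (1 + Real.exp x)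

lemma absTanhHalf_nonneg (x : ℝ) : 0 ≤ absTanhHalf x :=
  div_nonneg (abs_nonneg _) (by positivity)

lemma absTanhHalf_le_one (x : ℝ) : absTanhHalf x ≤ 1 := by
  have := Real.exp_pos x
  rw [absTanhHalf, div_le_one (by positivity), abs_le]
  constructor <;> linarith

lemma absTanhHalf_neg (x : ℝ) : absTanhHalf (-x) = absTanhHalf x := by
  have hx := Real.exp_pos x
  rw [absTanhHalf, absTanhHalf, Real.exp_neg, ← abs_neg (1 - Real.exp x),
    show -(1 - Real.exp x) = Real.exp x * (1 - (Real.exp x)⁻¹) by field_simp; ring,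
    abs_mul, abs_of_pos hx]
  field_simp
  rw [add_comm]

lemma absTanhHalf_mul_le {u v : ℝ} (h : |u| ≤ v) :
    absTanhHalf (u - v) * absTanhHalf (u + v) ≤ absTanhHalf v ^ 2 := by
  obtain ⟨h1, h2⟩ := abs_le.1 h
  have hx := Real.exp_pos u
  have hy := Real.exp_pos v
  have e1 : 1 - Real.exp (u - v) = (Real.exp v - Real.exp u) / Real.exp v := by
    rw [Real.exp_sub]; field_simp
  have e2 : 0 ≤ Real.exp v - Real.exp u := sub_nonneg.2 (Real.exp_le_exp.2 h2)
  have e3 : 1 ≤ Real.exp u * Real.exp v := by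
    rw [← Real.exp_add]; exact Real.one_le_exp (by linarith)
  rw [absTanhHalf, absTanhHalf, absTanhHalf, e1, abs_div, abs_of_nonneg e2, abs_of_pos hy,
    div_pow, sq_abs, Real.exp_sub, Real.exp_add, abs_sub_comm, abs_of_nonneg (sub_nonneg.2 e3)]
  generalize Real.exp u = x at *
  generalize Real.exp v = y at *
  have e4 : (y - x) / y / (1 + x / y) * ((x * y - 1) / (1 + x * y)) =
      ((y - x) * (x * y - 1)) / ((y + x) * (1 + x * y)) := by
    field_simp
  rw [e4, div_le_div_iff₀ (by positivity) (by positivity)]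
  have : 0 ≤ x * (y ^ 2 + 1) * y * (1 - x) ^ 2 := by positivity
  nlinarith

lemma tendsto_prod_absTanhHalf {s : ℝ} (hs : 0 < s) (w : ℝ) :
    Tendsto (fun N : ℕ => ∏ j ∈ Finset.range N,
      absTanhHalf (w - (2 * j + 1) * s) * absTanhHalf (w + (2 * j + 1) * s)) atTop
      (𝓝 (|signedTheta (-1) s w| / signedTheta 1 s w)) := by
  obtain ⟨c, hc, h⟩ := exists_tendsto_triple_product s hs
  have hpos := signedTheta_one_pos hs w
  have h1 := ((h (-1) w (by simp)).abs).div (h 1 w (by simp)) (mul_pos hc hpos).ne'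
  refine (h1.congr fun N => ?_).trans_eq ?_
  · rw [Pi.div_apply, Finset.abs_prod, ← Finset.prod_div_distrib]
    refine Finset.prod_congr rfl fun j _ => ?_
    rw [← absTanhHalf_neg (w + _), absTanhHalf, absTanhHalf, abs_mul, ← mul_div_mul_comm]
    ring_nf
  · rw [abs_mul, abs_of_pos hc, mul_div_mul_left _ _ hc.ne']

lemma abs_signedTheta_div_le {s : ℝ} (hs : 0 < s) (w : ℝ) (N : ℕ) :
    |signedTheta (-1) s w| / signedTheta 1 s w ≤ ∏ j ∈ Finset.range N,
      absTanhHalf (w - (2 * j + 1) * s) * absTanhHalf (w + (2 * j + 1) * s) := by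
  refine Antitone.le_of_tendsto (antitone_nat_of_succ_le fun m => ?_)
    (tendsto_prod_absTanhHalf hs w) N
  rw [Finset.prod_range_succ]
  refine mul_le_of_le_one_right (Finset.prod_nonneg fun j _ =>
    mul_nonneg (absTanhHalf_nonneg _) (absTanhHalf_nonneg _)) ?_
  exact mul_le_one₀ (absTanhHalf_le_one _) (absTanhHalf_nonneg _) (absTanhHalf_le_one _)

lemma prod_range_two_mul_mul (g : ℕ → ℝ) (k N : ℕ) :
    ∏ i ∈ Finset.range N, ∏ j ∈ Finset.range k,
      g (2 * i * k + (k - 1 - j)) * g ((2 * i + 1) * k + j) = ∏ l ∈ Finset.range (2 * N * k), g l := by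
  induction N with
  | zero => simp
  | succ N ih =>
    rw [Finset.prod_range_succ, ih, Finset.prod_mul_distrib,
      Finset.prod_range_reflect (fun j => g (2 * N * k + j)),
      show 2 * (N + 1) * k = 2 * N * k + k + k by ring, Finset.prod_range_add,
      Finset.prod_range_add, show (2 * N + 1) * k = 2 * N * k + k by ring, mul_assoc (∏ l ∈ _, g l)]

lemma antitone_prod_absTanhHalf (f : ℕ → ℝ) :
    Antitone fun n => ∏ l ∈ Finset.range n, absTanhHalf (f l) :=
  antitone_nat_of_succ_le fun m => by
    rw [Finset.prod_range_succ]
    exact mul_le_of_le_one_right (Finset.prod_nonneg fun j _ => absTanhHalf_nonneg _)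
      (absTanhHalf_le_one _)

lemma prod_absTanhHalf_shift (h w : ℝ) (n m c : ℕ) :
    (∏ l ∈ Finset.range (n + c), absTanhHalf (w - (l + 1 / 2) * h)) *
        ∏ l ∈ Finset.range m, absTanhHalf (w + (l + 1 / 2) * h) =
      (∏ l ∈ Finset.range n, absTanhHalf (w - c * h - (l + 1 / 2) * h)) *
        ∏ l ∈ Finset.range (m + c), absTanhHalf (w - c * h + (l + 1 / 2) * h) := by
  induction c generalizing n with
  | zero => simp
  | succ c ih =>
    rw [← add_assoc, add_right_comm, ih, Finset.prod_range_succ', ← add_assoc,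
      Finset.prod_range_succ' _ (m + c)]
    have e1 (l : ℕ) : w - c * h - (((l + 1 : ℕ) : ℝ) + 1 / 2) * h =
        w - ((c + 1 : ℕ) : ℝ) * h - (l + 1 / 2) * h := by push_cast; ring
    have e2 (l : ℕ) : w - ((c + 1 : ℕ) : ℝ) * h + (((l + 1 : ℕ) : ℝ) + 1 / 2) * h =
        w - c * h + (l + 1 / 2) * h := by push_cast; ring
    have e3 : w - c * h - (((0 : ℕ) : ℝ) + 1 / 2) * h =
        w - ((c + 1 : ℕ) : ℝ) * h + (((0 : ℕ) : ℝ) + 1 / 2) * h := by push_cast; ring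
    simp only [e1, e2, e3]
    ring

/-- The product of shifted theta quotients over equally spaced shifts is uniformly small. -/
lemma prod_signedTheta_div_le {h : ℝ} (hh : 0 < h) {k : ℕ} (hk : 0 < k) {w : ℝ}
    (hw : 0 ≤ w) :
    ∏ j ∈ Finset.range k,
      (|signedTheta (-1) (k * h) (w + (j + 1 / 2) * h)| / signedTheta 1 (k * h) (w + (j + 1 / 2) * h) *
        (|signedTheta (-1) (k * h) (w - (j + 1 / 2) * h)| /
          signedTheta 1 (k * h) (w - (j + 1 / 2) * h))) ≤
      2 * Real.exp (-(Real.pi ^ 2 / (2 * h))) := by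
  have hkh : 0 < k * h := by positivity
  set P := ∏ j ∈ Finset.range k,
      (|signedTheta (-1) (k * h) (w + (j + 1 / 2) * h)| / signedTheta 1 (k * h) (w + (j + 1 / 2) * h) *
        (|signedTheta (-1) (k * h) (w - (j + 1 / 2) * h)| /
          signedTheta 1 (k * h) (w - (j + 1 / 2) * h))) with hP
  have hwin (N : ℕ) : P ≤
      (∏ l ∈ Finset.range (2 * N * k), absTanhHalf (w - (l + 1 / 2) * h)) *
        ∏ l ∈ Finset.range (2 * N * k), absTanhHalf (w + (l + 1 / 2) * h) := by
    rw [← prod_range_two_mul_mul (fun l => absTanhHalf (w - (l + 1 / 2) * h)),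
      ← prod_range_two_mul_mul (fun l => absTanhHalf (w + (l + 1 / 2) * h)),
      ← Finset.prod_mul_distrib]
    simp only [← Finset.prod_mul_distrib]
    rw [Finset.prod_comm]
    refine Finset.prod_le_prod (fun j _ => mul_nonneg
      (div_nonneg (abs_nonneg _) (signedTheta_one_pos hkh _).le)
      (div_nonneg (abs_nonneg _) (signedTheta_one_pos hkh _).le)) fun j hj => ?_
    refine (mul_le_mul (abs_signedTheta_div_le hkh _ N) (abs_signedTheta_div_le hkh _ N)
      (div_nonneg (abs_nonneg _) (signedTheta_one_pos hkh _).le)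
      (Finset.prod_nonneg fun _ _ => mul_nonneg (absTanhHalf_nonneg _)
        (absTanhHalf_nonneg _))).trans_eq ?_
    rw [← Finset.prod_mul_distrib]
    refine Finset.prod_congr rfl fun i _ => ?_
    have hjk : ((k - 1 - j : ℕ) : ℝ) = k - 1 - j := by
      have := Finset.mem_range.1 hj
      rw [Nat.sub_sub, Nat.cast_sub (by omega)]; push_cast; ring
    have a1 : w + (j + 1 / 2) * h - (2 * i + 1) * (k * h) =
        w - (((2 * i * k + (k - 1 - j) : ℕ) : ℝ) + 1 / 2) * h := by
      push_cast [hjk]; ring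
    have a2 : w + (j + 1 / 2) * h + (2 * i + 1) * (k * h) =
        w + ((((2 * i + 1) * k + j : ℕ) : ℝ) + 1 / 2) * h := by
      push_cast; ring
    have a3 : w - (j + 1 / 2) * h - (2 * i + 1) * (k * h) =
        w - ((((2 * i + 1) * k + j : ℕ) : ℝ) + 1 / 2) * h := by
      push_cast; ring
    have a4 : w - (j + 1 / 2) * h + (2 * i + 1) * (k * h) =
        w + (((2 * i * k + (k - 1 - j) : ℕ) : ℝ) + 1 / 2) * h := by
      push_cast [hjk]; ring
    rw [a1, a2, a3, a4]
    ring
  obtain ⟨c, u, hu, hwu⟩ : ∃ (c : ℕ) (u : ℝ), |u| ≤ h / 2 ∧ w - c * h = u := by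
    refine ⟨⌊w / h + 1 / 2⌋₊, _, ?_, rfl⟩
    have h1 := Nat.floor_le (show 0 ≤ w / h + 1 / 2 by positivity)
    have h2 := Nat.lt_floor_add_one (w / h + 1 / 2)
    set f : ℝ := (⌊w / h + 1 / 2⌋₊ : ℝ)
    have hw' : w = w / h * h := by field_simp
    rw [abs_le]
    constructor <;> nlinarith
  have hfin (n : ℕ) : P ≤ ∏ l ∈ Finset.range n, absTanhHalf ((l + 1 / 2) * h) ^ 2 := by
    have hle : n + c ≤ 2 * (n + c) * k := by nlinarith
    refine (hwin (n + c)).trans ?_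
    calc _ ≤ (∏ l ∈ Finset.range (n + c), absTanhHalf (w - (l + 1 / 2) * h)) *
          ∏ l ∈ Finset.range n, absTanhHalf (w + (l + 1 / 2) * h) :=
        mul_le_mul (antitone_prod_absTanhHalf _ hle)
          (antitone_prod_absTanhHalf _ (le_trans (Nat.le_add_right _ _) hle))
          (Finset.prod_nonneg fun _ _ => absTanhHalf_nonneg _)
          (Finset.prod_nonneg fun _ _ => absTanhHalf_nonneg _)
      _ = (∏ l ∈ Finset.range n, absTanhHalf (u - (l + 1 / 2) * h)) *
          ∏ l ∈ Finset.range (n + c), absTanhHalf (u + (l + 1 / 2) * h) := by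
        rw [prod_absTanhHalf_shift, hwu]
      _ ≤ (∏ l ∈ Finset.range n, absTanhHalf (u - (l + 1 / 2) * h)) *
          ∏ l ∈ Finset.range n, absTanhHalf (u + (l + 1 / 2) * h) :=
        mul_le_mul_of_nonneg_left (antitone_prod_absTanhHalf _ (Nat.le_add_right _ _))
          (Finset.prod_nonneg fun _ _ => absTanhHalf_nonneg _)
      _ ≤ _ := by
        rw [← Finset.prod_mul_distrib]
        refine Finset.prod_le_prod (fun _ _ => mul_nonneg (absTanhHalf_nonneg _)
          (absTanhHalf_nonneg _)) fun l _ => absTanhHalf_mul_le (hu.trans ?_)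
        have : (0 : ℝ) ≤ l := Nat.cast_nonneg l
        nlinarith
  have hh2 : 0 < h / 2 := by positivity
  have hlim := tendsto_prod_absTanhHalf hh2 0
  have hPle : P ≤ |signedTheta (-1) (h / 2) 0| / signedTheta 1 (h / 2) 0 := by
    refine ge_of_tendsto' hlim fun n => (hfin n).trans_eq ?_
    refine Finset.prod_congr rfl fun l _ => ?_
    rw [zero_sub, absTanhHalf_neg, zero_add, sq, show (2 * l + 1) * (h / 2) = (l + 1 / 2) * h by ring]
  refine hPle.trans ?_
  rw [div_le_iff₀ (signedTheta_one_pos hh2 0)]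
  have := signedTheta_neg_one_le hh2
  rwa [show 4 * (h / 2) = 2 * h by ring] at this

lemma evenTheta_pos {s : ℝ} (hs : 0 < s) (w : ℝ) : 0 < evenTheta s w := by
  rw [evenTheta_eq]; exact signedTheta_one_pos (by positivity) _

lemma oddTheta_pos {s : ℝ} (hs : 0 < s) (w : ℝ) : 0 < oddTheta s w := by
  rw [oddTheta_eq]; exact mul_pos (Real.exp_pos _) (signedTheta_one_pos (by positivity) _)

lemma continuous_evenTheta {s : ℝ} (hs : 0 < s) : Continuous (evenTheta s) := by
  have := continuous_signedTheta_one (s := 2 * s) (by positivity)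
  rw [funext (evenTheta_eq s)]
  fun_prop

lemma continuous_oddTheta {s : ℝ} (hs : 0 < s) : Continuous (oddTheta s) := by
  have := continuous_signedTheta_one (s := 2 * s) (by positivity)
  rw [funext (oddTheta_eq s)]
  fun_prop

lemma oddTheta_self (s : ℝ) : oddTheta s s = Real.exp (s / 2) * evenTheta s 0 := by
  rw [oddTheta, evenTheta, ← tsum_mul_left]
  refine tsum_congr fun n => ?_
  rw [← Real.exp_add]; ring_nf

lemma evenTheta_self (s : ℝ) : evenTheta s s = Real.exp (s / 2) * oddTheta s 0 := by
  rw [oddTheta, evenTheta, ← tsum_mul_left, ← (Equiv.addRight (1 : ℤ)).tsum_eq]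
  refine tsum_congr fun n => ?_
  rw [← Real.exp_add]; push_cast [Equiv.coe_addRight]; ring_nf

lemma oddTheta_zero_le {s : ℝ} (hs : 0 < s) :
    oddTheta s 0 ≤ Real.exp (-(s / 2)) * (2 * evenTheta s 0) := by
  have h := tsum_half_gaussian_le (r := 2 * s) (by positivity)
  have h1 : oddTheta s 0 = Real.exp (-(s / 2)) * ∑' n : ℤ, Real.exp (-(2 * s) * (n ^ 2 + n)) := by
    rw [oddTheta, ← tsum_mul_left]
    refine tsum_congr fun n => ?_
    rw [← Real.exp_add]; ring_nf
  have h2 : evenTheta s 0 = ∑' n : ℤ, Real.exp (-(2 * s) * n ^ 2) :=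
    tsum_congr fun n => by ring_nf
  rw [h1, h2]
  exact mul_le_mul_of_nonneg_left h (Real.exp_pos _).le

/-- A ratio of theta series takes every value between `√(a / b)` and `√(b / a)`. -/
lemma exists_theta_ratio_eq {a b y : ℝ} (ha : 0 < a) (hab : a < b) (hy : y ∈ Set.Icc a b) :
    ∃ w, 0 ≤ w ∧ y = √(a * b) *
      (oddTheta (Real.log (4 * b / a)) w / evenTheta (Real.log (4 * b / a)) w) := by
  set M := Real.log (4 * b / a) with hM
  have hb : 0 < b := ha.trans hab
  have hM0 : 0 < M := Real.log_pos (by rw [lt_div_iff₀ ha]; linarith)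
  have hexp : Real.exp (M / 2) ^ 2 = 4 * b / a := by
    rw [← Real.exp_nat_mul, ← Real.exp_log (show 0 < 4 * b / a by positivity)]
    congr 1; push_cast; ring
  set c := √(a * b)
  have hc : 0 < c := Real.sqrt_pos.2 (mul_pos ha hb)
  have hc2 : c ^ 2 = a * b := Real.sq_sqrt (mul_pos ha hb).le
  have hcont : Continuous fun w => c * (oddTheta M w / evenTheta M w) :=
    continuous_const.mul ((continuous_oddTheta hM0).div₀ (continuous_evenTheta hM0)
      fun w => (evenTheta_pos hM0 w).ne')
  have hE := evenTheta_pos hM0 0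
  have hO := oddTheta_pos hM0 0
  have hle := oddTheta_zero_le hM0
  have hce : 2 * b ≤ c * Real.exp (M / 2) := by
    refine le_of_eq (((sq_eq_sq₀ (by positivity) (by positivity)).1 ?_))
    rw [mul_pow, mul_pow, hc2, hexp]; field_simp; norm_num
  have hbκ : b * oddTheta M 0 ≤ c * evenTheta M 0 := by
    rw [Real.exp_neg, inv_mul_eq_div, le_div_iff₀ (Real.exp_pos _)] at hle
    have : b * (oddTheta M 0 * Real.exp (M / 2)) ≤ (c * Real.exp (M / 2)) * evenTheta M 0 := by
      nlinarith
    refine le_of_mul_le_mul_right ?_ (Real.exp_pos (M / 2))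
    linarith
  have h0 : c * (oddTheta M 0 / evenTheta M 0) ≤ a := by
    rw [← mul_div_assoc, div_le_iff₀ hE]
    refine le_of_mul_le_mul_left ?_ hb
    have := mul_le_mul_of_nonneg_left hbκ hc.le
    nlinarith
  have h1 : b ≤ c * (oddTheta M M / evenTheta M M) := by
    rw [oddTheta_self, evenTheta_self, mul_div_mul_left _ _ (Real.exp_pos _).ne',
      ← mul_div_assoc, le_div_iff₀ hO]
    exact hbκ
  obtain ⟨w, hw, hwy⟩ := intermediate_value_Icc hM0.le hcont.continuousOn
    ⟨h0.trans hy.1, hy.2.trans h1⟩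
  exact ⟨w, hw.1, hwy.symm⟩

/-- An explicit bound for Zolotarev's rational approximation problem on `[-b, -a] ∪ [a, b]`. -/
theorem exists_zolotarev_shifts {a b : ℝ} (ha : 0 < a) (hab : a < b) (k : ℕ) :
    ∃ p : ℕ → ℝ, (∀ i, 0 < p i) ∧ ∀ y ∈ Set.Icc a b,
      |∏ i ∈ Finset.range k, (y - p i) / (y + p i)| ≤
        2 * Real.exp (-(k * Real.pi ^ 2 / (2 * Real.log (4 * b / a)))) := by
  rcases k.eq_zero_or_pos with rfl | hk
  · exact ⟨fun _ => 1, fun _ => one_pos, fun y _ => by norm_num⟩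
  have hM0 : 0 < Real.log (4 * b / a) := Real.log_pos (by rw [lt_div_iff₀ ha]; linarith)
  set M := Real.log (4 * b / a) with hM
  have hc : 0 < √(a * b) := Real.sqrt_pos.2 (mul_pos ha (ha.trans hab))
  have hk' : (0 : ℝ) < k := Nat.cast_pos.2 hk
  have hkh : k * (M / k) = M := by field_simp
  refine ⟨fun j => √(a * b) * (evenTheta M ((j + 1 / 2) * (M / k)) /
    oddTheta M ((j + 1 / 2) * (M / k))), fun j => mul_pos hc
    (div_pos (evenTheta_pos hM0 _) (oddTheta_pos hM0 _)), fun y hy => ?_⟩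
  obtain ⟨w, hw, rfl⟩ := exists_theta_ratio_eq ha hab hy
  have h := prod_signedTheta_div_le (h := M / k) (by positivity) hk hw
  rw [hkh, show Real.pi ^ 2 / (2 * (M / k)) = k * Real.pi ^ 2 / (2 * M) by field_simp] at h
  refine le_trans (le_of_eq ?_) h
  rw [Finset.abs_prod]
  refine Finset.prod_congr rfl fun j _ => ?_
  set v := ((j : ℝ) + 1 / 2) * (M / k)
  rw [div_mul_div_comm, ← abs_mul, signedTheta_mul_signedTheta (by simp) hM0,
    signedTheta_mul_signedTheta (by simp) hM0, ← hM]
  have e1 := evenTheta_pos hM0 w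
  have e2 := oddTheta_pos hM0 w
  have e3 := evenTheta_pos hM0 v
  have e4 := oddTheta_pos hM0 v
  set E := evenTheta M w
  set O := oddTheta M w
  set E' := evenTheta M v
  set O' := oddTheta M v
  have e5 : 0 < E * E' + 1 * (O * O') := by positivity
  rw [← abs_of_pos e5, ← abs_div, ← abs_neg]
  change |-((√(a * b) * (O / E) - √(a * b) * (E' / O')) /
    (√(a * b) * (O / E) + √(a * b) * (E' / O')))| = _
  congr 1
  field_simp
  ring

end Theta

namespace Matrix

open scoped Matrix.Norms.L2Operator

variable {m n : ℕ} {A : Matrix (Fin m) (Fin m) ℂ} {B : Matrix (Fin n) (Fin n) ℂ}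
  {X G : Matrix (Fin m) (Fin n) ℂ} {a b : ℝ}

lemma isSelfAdjoint_of_spectrum_subset_real {s : Set ℝ} (hA : A * Aᴴ = Aᴴ * A)
    (hs : spectrum ℂ A ⊆ (fun r : ℝ => (r : ℂ)) '' s) : IsSelfAdjoint A := by
  have hn : IsStarNormal A := ⟨hA.symm⟩
  rw [isSelfAdjoint_iff]
  nth_rw 2 [← cfc_id ℂ A]
  rw [← cfc_star_id (R := ℂ) A]
  refine cfc_congr fun x hx => ?_
  obtain ⟨r, -, rfl⟩ := hs hx
  exact Complex.conj_ofReal r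

lemma real_spectrum_subset {s : Set ℝ}
    (hs : spectrum ℂ A ⊆ (fun r : ℝ => (r : ℂ)) '' s) : spectrum ℝ A ⊆ s := fun r hr => by
  obtain ⟨r', hr', h⟩ := hs ((spectrum.algebraMap_mem_iff ℂ).2 hr)
  rwa [show r = r' from (Complex.ofReal_inj.1 h).symm]

lemma continuousOn_real_spectrum (f : ℝ → ℝ) (A : Matrix (Fin m) (Fin m) ℂ) :
    ContinuousOn f (spectrum ℝ A) := Matrix.finite_real_spectrum.continuousOn f

lemma cfc_mul' (f g : ℝ → ℝ) (A : Matrix (Fin m) (Fin m) ℂ) :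
    cfc (fun x => f x * g x) A = cfc f A * cfc g A :=
  cfc_mul f g A (continuousOn_real_spectrum f A) (continuousOn_real_spectrum g A)

lemma cfc_add_real (hA : IsSelfAdjoint A) (p : ℝ) : cfc (fun x : ℝ => x + p) A = A + p • 1 := by
  rw [cfc_add_const p (fun x => x) A, cfc_id' ℝ A, Algebra.algebraMap_eq_smul_one]

lemma norm_le_of_spectrum (hA : IsSelfAdjoint A) (hb : 0 ≤ b) (h : ∀ x ∈ spectrum ℝ A, |x| ≤ b) :
    ‖A‖ ≤ b := by
  rw [← cfc_id ℝ A]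
  exact norm_cfc_le hb h

/-- One step of the alternating direction implicit iteration. -/
lemma sylvester_sub_shift (hA : IsSelfAdjoint A) (hB : IsSelfAdjoint B) {p : ℝ}
    (hpA : ∀ x ∈ spectrum ℝ A, x - p ≠ 0) (hpB : ∀ x ∈ spectrum ℝ B, x + p ≠ 0)
    (h : A * X - X * B = G) :
    X - cfc (fun x : ℝ => (x + p) / (x - p)) A * X * cfc (fun x : ℝ => (x - p) / (x + p)) B =
      (2 * p) • (cfc (fun x : ℝ => (x - p)⁻¹) A * G * cfc (fun x : ℝ => (x + p)⁻¹) B) := by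
  have hR : cfc (fun x : ℝ => (x - p)⁻¹) A * (A + (-p) • 1) = 1 := by
    rw [← cfc_add_real hA, ← cfc_mul', ← cfc_one ℝ A]
    exact cfc_congr fun x hx => inv_mul_cancel₀ (hpA x hx)
  have hS : (B + p • 1) * cfc (fun x : ℝ => (x + p)⁻¹) B = 1 := by
    rw [← cfc_add_real hB, ← cfc_mul', ← cfc_one ℝ B]
    exact cfc_congr fun x hx => mul_inv_cancel₀ (hpB x hx)
  have hC : cfc (fun x : ℝ => (x + p) / (x - p)) A =
      cfc (fun x : ℝ => (x - p)⁻¹) A * (A + p • 1) := by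
    rw [← cfc_add_real hA, ← cfc_mul']
    exact cfc_congr fun x _ => by ring
  have hD : cfc (fun x : ℝ => (x - p) / (x + p)) B =
      (B + (-p) • 1) * cfc (fun x : ℝ => (x + p)⁻¹) B := by
    rw [← cfc_add_real hB, ← cfc_mul']
    exact cfc_congr fun x _ => by ring
  set R := cfc (fun x : ℝ => (x - p)⁻¹) A
  set S := cfc (fun x : ℝ => (x + p)⁻¹) B
  have key : (A + (-p) • (1 : Matrix _ _ ℂ)) * X * (B + p • (1 : Matrix _ _ ℂ)) -
      (A + p • (1 : Matrix _ _ ℂ)) * X * (B + (-p) • (1 : Matrix _ _ ℂ)) = (2 * p) • G := by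
    rw [← h]
    simp only [Matrix.add_mul, Matrix.mul_add, Matrix.smul_mul, Matrix.mul_smul, Matrix.one_mul,
      Matrix.mul_one]
    module
  have hX : X = R * ((A + (-p) • 1) * X * (B + p • 1)) * S := by
    calc X = (R * (A + (-p) • 1)) * X * ((B + p • 1) * S) := by
          rw [hR, hS, Matrix.one_mul, Matrix.mul_one]
      _ = _ := by simp only [Matrix.mul_assoc]
  rw [hC, hD]
  nth_rw 1 [hX]
  rw [show R * (A + p • 1) * X * ((B + (-p) • 1) * S) =
    R * ((A + p • 1) * X * (B + (-p) • 1)) * S by simp only [Matrix.mul_assoc],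
    ← Matrix.sub_mul, ← Matrix.mul_sub, key, Matrix.mul_smul, Matrix.smul_mul]

/-- The solution operator of a Sylvester equation with spectra separated by `2 a` has norm at most
`1 / (2 a)`. -/
lemma norm_sylvester_solution_le (hA : IsSelfAdjoint A) (hB : IsSelfAdjoint B)
    (ha : 0 < a) (hab : a ≤ b) (hsA : spectrum ℝ A ⊆ Set.Icc (-b) (-a))
    (hsB : spectrum ℝ B ⊆ Set.Icc a b) (h : A * X - X * B = G) : 2 * a * ‖X‖ ≤ ‖G‖ := by
  have hb : 0 < b := ha.trans_le hab
  have hstep := sylvester_sub_shift (p := b) hA hB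
    (fun x hx => by have := (hsA hx).2; linarith) (fun x hx => by have := (hsB hx).1; linarith) h
  set r := (b - a) / (b + a)
  have hr : 0 ≤ r := div_nonneg (by linarith) (by linarith)
  have hC : ‖cfc (fun x : ℝ => (x + b) / (x - b)) A‖ ≤ r := by
    refine norm_cfc_le hr fun x hx => ?_
    have h1 := hsA hx
    rw [Real.norm_eq_abs, abs_div, abs_of_nonneg (by linarith [h1.1]),
      abs_of_neg (by linarith [h1.2]), div_le_div_iff₀ (by linarith [h1.2]) (by linarith)]
    nlinarith [h1.1, h1.2]
  have hD : ‖cfc (fun x : ℝ => (x - b) / (x + b)) B‖ ≤ r := by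
    refine norm_cfc_le hr fun x hx => ?_
    have h1 := hsB hx
    rw [Real.norm_eq_abs, abs_div, abs_of_nonpos (by linarith [h1.2]),
      abs_of_pos (by linarith [h1.1]), div_le_div_iff₀ (by linarith [h1.1]) (by linarith)]
    nlinarith [h1.1, h1.2]
  have hba : 0 < (b + a)⁻¹ := by positivity
  have hR : ‖cfc (fun x : ℝ => (x - b)⁻¹) A‖ ≤ (b + a)⁻¹ := by
    refine norm_cfc_le hba.le fun x hx => ?_
    have h1 := hsA hx
    rw [Real.norm_eq_abs, abs_inv, abs_of_neg (by linarith [h1.2])]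
    exact inv_anti₀ (by linarith) (by linarith [h1.2])
  have hS : ‖cfc (fun x : ℝ => (x + b)⁻¹) B‖ ≤ (b + a)⁻¹ := by
    refine norm_cfc_le hba.le fun x hx => ?_
    have h1 := hsB hx
    rw [Real.norm_eq_abs, abs_inv, abs_of_pos (by linarith [h1.1])]
    exact inv_anti₀ (by linarith) (by linarith [h1.1])
  have hmul {C : Matrix (Fin m) (Fin m) ℂ} {D : Matrix (Fin n) (Fin n) ℂ} {c : ℝ} (hc : 0 ≤ c)
      (hC : ‖C‖ ≤ c) (hD : ‖D‖ ≤ c) (Y : Matrix (Fin m) (Fin n) ℂ) : ‖C * Y * D‖ ≤ c ^ 2 * ‖Y‖ := by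
    calc ‖C * Y * D‖ ≤ ‖C * Y‖ * ‖D‖ := l2_opNorm_mul _ _
      _ ≤ ‖C‖ * ‖Y‖ * ‖D‖ := by gcongr; exact l2_opNorm_mul _ _
      _ ≤ c * ‖Y‖ * c := by gcongr
      _ = _ := by ring
  have h1 := hmul hr hC hD X
  have h2 := hmul hba.le hR hS G
  have h3 : ‖X‖ ≤ r ^ 2 * ‖X‖ + 2 * b * ((b + a)⁻¹ ^ 2 * ‖G‖) := by
    rw [sub_eq_iff_eq_add'] at hstep
    calc ‖X‖ ≤ _ + _ := (congrArg norm hstep).trans_le (norm_add_le _ _)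
      _ ≤ _ := by
        refine add_le_add h1 ?_
        rw [← Complex.coe_smul, norm_smul, Complex.norm_real, Real.norm_of_nonneg (by positivity)]
        gcongr
  have hba' : 0 < b + a := by linarith
  have h4 : (b + a) ^ 2 * ‖X‖ ≤ (b - a) ^ 2 * ‖X‖ + 2 * b * ‖G‖ := by
    refine (mul_le_mul_of_nonneg_left h3 (sq_nonneg (b + a))).trans_eq ?_
    simp only [r]; field_simp
  refine le_of_mul_le_mul_left ?_ (show 0 < 2 * b by linarith)
  linarith

lemma rank_add_le (M N : Matrix (Fin m) (Fin n) ℂ) : (M + N).rank ≤ M.rank + N.rank := by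
  rw [rank, rank, rank, mulVecLin_add]
  exact (Submodule.finrank_mono (LinearMap.range_add_le _ _)).trans
    (Submodule.finrank_add_le_finrank_add_finrank _ _)

lemma rank_sum_le {ι : Type*} (s : Finset ι) (M : ι → Matrix (Fin m) (Fin n) ℂ) :
    (∑ i ∈ s, M i).rank ≤ ∑ i ∈ s, (M i).rank := by
  classical
  induction s using Finset.induction_on with
  | empty => simp
  | insert i s hi ih =>
    rw [Finset.sum_insert hi, Finset.sum_insert hi]
    exact (rank_add_le _ _).trans (Nat.add_le_add_left ih _)

/-- After `l` steps of the alternating direction implicit iteration for a right-hand side of rank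
at most one, the iterate has rank at most `l`. -/
lemma rank_sub_adi_le (hA : IsSelfAdjoint A) (hB : IsSelfAdjoint B)
    (hsA : spectrum ℝ A ⊆ Set.Iio 0) (hsB : spectrum ℝ B ⊆ Set.Ioi 0)
    (h : A * X - X * B = G) (hG : G.rank ≤ 1) {p : ℕ → ℝ} (hp : ∀ i, 0 < p i) (l : ℕ) :
    (X - cfc (fun x : ℝ => ∏ i ∈ Finset.range l, (x + p i) / (x - p i)) A * X *
      cfc (fun x : ℝ => ∏ i ∈ Finset.range l, (x - p i) / (x + p i)) B).rank ≤ l := by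
  induction l with
  | zero =>
    simp only [Finset.range_zero, Finset.prod_empty]
    rw [cfc_const_one ℝ A, cfc_const_one ℝ B]
    simp
  | succ l ih =>
    simp only [Finset.prod_range_succ]
    rw [cfc_mul', cfc_mul', (cfc_commute_cfc (R := ℝ) _ _ B).eq]
    set C := cfc (fun x : ℝ => ∏ i ∈ Finset.range l, (x + p i) / (x - p i)) A
    set D := cfc (fun x : ℝ => ∏ i ∈ Finset.range l, (x - p i) / (x + p i)) B
    set c := cfc (fun x : ℝ => (x + p l) / (x - p l)) A with hc
    set d := cfc (fun x : ℝ => (x - p l) / (x + p l)) B with hd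
    have hstep := sylvester_sub_shift (p := p l) hA hB
      (fun x hx => by have := hsA hx; have := hp l; simp only [Set.mem_Iio] at *; linarith)
      (fun x hx => by have := hsB hx; have := hp l; simp only [Set.mem_Ioi] at *; linarith) h
    rw [← hc, ← hd] at hstep
    have : X - C * c * X * (d * D) = (X - C * X * D) + C * (X - c * X * d) * D := by
      simp only [Matrix.mul_sub, Matrix.sub_mul, Matrix.mul_assoc]
      abel
    rw [this]
    refine (rank_add_le _ _).trans (Nat.add_le_add ih ?_)
    refine (rank_mul_le_left _ _).trans ((rank_mul_le_right _ _).trans ?_)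
    rw [hstep, ← Matrix.mul_smul]
    refine (rank_mul_le_left _ _).trans ?_
    exact (rank_mul_le_right _ _).trans hG

/-- A singular value decomposition: an orthonormal basis of right singular vectors, ordered by
decreasing singular value. -/
lemma exists_right_singular_basis (F : Matrix (Fin m) (Fin n) ℂ) :
    ∃ (v : OrthonormalBasis (Fin n) ℂ (EuclideanSpace ℂ (Fin n))) (σ : Fin n → ℝ),
      Antitone σ ∧ (∀ i, 0 ≤ σ i) ∧ ∀ (s : Finset (Fin n)) (c : Fin n → ℂ),
        ‖toEuclideanLin F (∑ i ∈ s, c i • v i)‖ ^ 2 = ∑ i ∈ s, ‖c i‖ ^ 2 * σ i ^ 2 := by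
  set T := toEuclideanLin F
  have hP := T.isPositive_adjoint_comp_self
  have hn : Module.finrank ℂ (EuclideanSpace ℂ (Fin n)) = n := finrank_euclideanSpace_fin
  set v := hP.isSymmetric.eigenvectorBasis hn
  have h0 (i : Fin n) : 0 ≤ hP.isSymmetric.eigenvalues hn i := hP.nonneg_eigenvalues hn i
  refine ⟨v, fun i => √(hP.isSymmetric.eigenvalues hn i), fun i j hij =>
    Real.sqrt_le_sqrt (hP.isSymmetric.eigenvalues_antitone hn hij),
    fun i => Real.sqrt_nonneg _, fun s c => ?_⟩
  set x := ∑ i ∈ s, c i • v i with hx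
  have hTx : (T.adjoint ∘ₗ T) x =
      ∑ i ∈ s, (c i * (hP.isSymmetric.eigenvalues hn i : ℂ)) • v i := by
    rw [hx, map_sum]
    refine Finset.sum_congr rfl fun i _ => ?_
    rw [map_smul, hP.isSymmetric.apply_eigenvectorBasis hn i, smul_smul]
    rfl
  have hin : ((‖T x‖ ^ 2 : ℝ) : ℂ) = inner ℂ x ((T.adjoint ∘ₗ T) x) := by
    rw [LinearMap.comp_apply, LinearMap.adjoint_inner_right, inner_self_eq_norm_sq_to_K]
    push_cast
    rfl
  apply Complex.ofReal_injective
  rw [hin, hTx, hx, v.orthonormal.inner_sum]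
  push_cast
  refine Finset.sum_congr rfl fun i _ => ?_
  rw [← mul_assoc, Complex.conj_mul', ← Complex.ofReal_pow (√_), Real.sq_sqrt (h0 i)]

lemma norm_toEuclideanLin_le (M : Matrix (Fin m) (Fin n) ℂ) (x : EuclideanSpace ℂ (Fin n)) :
    ‖toEuclideanLin M x‖ ≤ ‖M‖ * ‖x‖ :=
  (LinearMap.toContinuousLinearMap (toEuclideanLin M)).le_opNorm x

lemma norm_le_of_forall {M : Matrix (Fin m) (Fin n) ℂ} {c : ℝ} (hc : 0 ≤ c)
    (h : ∀ x, ‖toEuclideanLin M x‖ ≤ c * ‖x‖) : ‖M‖ ≤ c :=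
  ContinuousLinearMap.opNorm_le_bound _ hc h

lemma rank_eq_finrank_range (M : Matrix (Fin m) (Fin n) ℂ) :
    M.rank = Module.finrank ℂ (LinearMap.range (toEuclideanLin M)) := by
  rw [toEuclideanLin_eq_toLin_orthonormal]
  exact rank_eq_finrank_range_toLin M _ _

/-- One half of the Eckart–Young theorem: a singular value is a lower bound for the distance to
matrices of small rank. -/
lemma singular_le_norm_sub {F N : Matrix (Fin m) (Fin n) ℂ}
    {v : OrthonormalBasis (Fin n) ℂ (EuclideanSpace ℂ (Fin n))} {σ : Fin n → ℝ}
    (hσ : Antitone σ) (hσ0 : ∀ i, 0 ≤ σ i)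
    (hv : ∀ (s : Finset (Fin n)) (c : Fin n → ℂ),
      ‖toEuclideanLin F (∑ i ∈ s, c i • v i)‖ ^ 2 = ∑ i ∈ s, ‖c i‖ ^ 2 * σ i ^ 2)
    (j : Fin n) (hN : N.rank ≤ j) : σ j ≤ ‖F - N‖ := by
  let L : (Finset.Iic j → ℂ) →ₗ[ℂ] EuclideanSpace ℂ (Fin n) :=
    Fintype.linearCombination ℂ fun i : Finset.Iic j => v i
  have hker : LinearMap.ker (toEuclideanLin N ∘ₗ L) ≠ ⊥ := by
    intro hk
    have h1 := LinearMap.finrank_range_of_inj (LinearMap.ker_eq_bot.1 hk)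
    rw [Module.finrank_fintype_fun_eq_card, Fintype.card_coe, Fin.card_Iic] at h1
    have h2 := Submodule.finrank_mono (LinearMap.range_comp_le_range L (toEuclideanLin N))
    rw [← rank_eq_finrank_range] at h2
    omega
  obtain ⟨c, hc, hc0⟩ := Submodule.exists_mem_ne_zero_of_ne_bot hker
  set c' : Fin n → ℂ := fun i => if h : i ∈ Finset.Iic j then c ⟨i, h⟩ else 0 with hc'
  have hL : L c = ∑ i ∈ Finset.Iic j, c' i • v i := by
    rw [Fintype.linearCombination_apply, ← Finset.sum_coe_sort (Finset.Iic j)]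
    refine Finset.sum_congr rfl fun i _ => ?_
    rw [show c' i = c i by simp only [hc', i.2, dif_pos]]
  have hx2 : ‖L c‖ ^ 2 = ∑ i ∈ Finset.Iic j, ‖c' i‖ ^ 2 := by
    have := v.orthonormal.inner_sum c' c' (Finset.Iic j)
    rw [← hL, inner_self_eq_norm_sq_to_K] at this
    apply Complex.ofReal_injective
    push_cast
    refine this.trans (Finset.sum_congr rfl fun i _ => Complex.conj_mul' _)
  have hpos : 0 < ‖L c‖ ^ 2 := by
    obtain ⟨i, hi⟩ := Function.ne_iff.1 hc0
    rw [hx2]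
    refine lt_of_lt_of_le ?_ (Finset.single_le_sum (f := fun i => ‖c' i‖ ^ 2)
      (fun _ _ => sq_nonneg _) i.2)
    have : c' i = c i := by simp only [hc', i.2, dif_pos]
    rw [this]
    exact pow_pos (norm_pos_iff.2 hi) 2
  have hFN : toEuclideanLin (F - N) (L c) = toEuclideanLin F (L c) := by
    have hz : toEuclideanLin N (L c) = 0 := hc
    rw [map_sub, LinearMap.sub_apply, hz, sub_zero]
  have hle : σ j ^ 2 * ‖L c‖ ^ 2 ≤ ‖F - N‖ ^ 2 * ‖L c‖ ^ 2 := by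
    calc σ j ^ 2 * ‖L c‖ ^ 2 ≤ ‖toEuclideanLin F (L c)‖ ^ 2 := by
          rw [hx2, hL, hv, Finset.mul_sum]
          refine Finset.sum_le_sum fun i hi => ?_
          rw [mul_comm]
          have := hσ0 j
          gcongr
          exact hσ (Finset.mem_Iic.1 hi)
      _ ≤ (‖F - N‖ * ‖L c‖) ^ 2 := by
          rw [← hFN]
          gcongr
          exact norm_toEuclideanLin_le _ _
      _ = _ := by ring
  exact (sq_le_sq₀ (hσ0 j) (norm_nonneg _)).1 (le_of_mul_le_mul_right hle hpos)

/-- The matrix of the orthogonal projection onto a vector of an orthonormal basis. -/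
noncomputable def basisProj (v : OrthonormalBasis (Fin n) ℂ (EuclideanSpace ℂ (Fin n)))
    (i : Fin n) : Matrix (Fin n) (Fin n) ℂ :=
  vecMulVec (v i) (star (v i))

lemma toEuclideanLin_basisProj (v : OrthonormalBasis (Fin n) ℂ (EuclideanSpace ℂ (Fin n)))
    (i : Fin n) (x : EuclideanSpace ℂ (Fin n)) :
    toEuclideanLin (basisProj v i) x = inner ℂ (v i) x • v i := by
  ext l
  simp [basisProj, toLpLin_apply, vecMulVec_mulVec, EuclideanSpace.inner_eq_star_dotProduct,
    dotProduct_comm, mul_comm]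

lemma sum_basisProj (v : OrthonormalBasis (Fin n) ℂ (EuclideanSpace ℂ (Fin n))) :
    ∑ i, basisProj v i = 1 := by
  apply toEuclideanLin.injective
  ext1 x
  rw [map_sum, LinearMap.sum_apply]
  simp_rw [toEuclideanLin_basisProj]
  rw [v.sum_repr' x]
  simp

/-- The restriction of a matrix to the span of right singular vectors has norm at most the largest
of the corresponding singular values. -/
lemma norm_mul_sum_basisProj_le {F : Matrix (Fin m) (Fin n) ℂ}
    {v : OrthonormalBasis (Fin n) ℂ (EuclideanSpace ℂ (Fin n))} {σ : Fin n → ℝ}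
    (hσ0 : ∀ i, 0 ≤ σ i)
    (hv : ∀ (s : Finset (Fin n)) (c : Fin n → ℂ),
      ‖toEuclideanLin F (∑ i ∈ s, c i • v i)‖ ^ 2 = ∑ i ∈ s, ‖c i‖ ^ 2 * σ i ^ 2)
    {s : Finset (Fin n)} {r : ℝ} (hr : 0 ≤ r) (hs : ∀ i ∈ s, σ i ≤ r) :
    ‖F * ∑ i ∈ s, basisProj v i‖ ≤ r := by
  refine norm_le_of_forall hr fun x => ?_
  have h1 : toEuclideanLin (F * ∑ i ∈ s, basisProj v i) x =
      toEuclideanLin F (∑ i ∈ s, inner ℂ (v i) x • v i) := by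
    simp_rw [← toEuclideanLin_basisProj]
    rw [← LinearMap.sum_apply, ← map_sum]
    simp [toLpLin_apply]
  rw [← sq_le_sq₀ (norm_nonneg _) (by positivity), h1, hv, mul_pow, ← v.sum_sq_norm_inner_right x,
    Finset.mul_sum]
  calc ∑ i ∈ s, ‖inner ℂ (v i) x‖ ^ 2 * σ i ^ 2 ≤ ∑ i ∈ s, r ^ 2 * ‖inner ℂ (v i) x‖ ^ 2 := by
        refine Finset.sum_le_sum fun i hi => ?_
        have := hσ0 i
        have := hs i hi
        rw [mul_comm]
        gcongr
    _ ≤ _ := Finset.sum_le_sum_of_subset_of_nonneg (Finset.subset_univ s)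
        fun _ _ _ => by positivity

/-- A matrix splits into terms of rank at most one and a remainder, with norms bounded by
quantities that bound its distances to the matrices of low rank. -/
lemma exists_rank_one_decomposition (F : Matrix (Fin m) (Fin n) ℂ) {k : ℕ} (hk : k < n) {τ : ℕ → ℝ}
    (hτ : ∀ j < n, ∀ r : ℝ, (∀ N : Matrix (Fin m) (Fin n) ℂ, N.rank < j + 1 → r ≤ ‖F - N‖) →
      r ≤ τ j) :
    ∃ (f : ℕ → Matrix (Fin m) (Fin n) ℂ) (g : Matrix (Fin m) (Fin n) ℂ),
      F = ∑ j ∈ Finset.range k, f j + g ∧ (∀ j < k, (f j).rank ≤ 1 ∧ ‖f j‖ ≤ τ j) ∧ ‖g‖ ≤ τ k := by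
  obtain ⟨v, σ, hσ, hσ0, hv⟩ := exists_right_singular_basis F
  have hστ (j : Fin n) : σ j ≤ τ j :=
    hτ j j.2 _ fun N hN => singular_le_norm_sub hσ hσ0 hv j (Nat.lt_succ_iff.1 hN)
  refine ⟨fun j => if h : j < n then F * basisProj v ⟨j, h⟩ else 0,
    F * ∑ i ∈ Finset.Ici (⟨k, hk⟩ : Fin n), basisProj v i, ?_, fun j hj => ?_, ?_⟩
  · have h1 : ∑ j ∈ Finset.range k, (if h : j < n then F * basisProj v ⟨j, h⟩ else 0) =
        F * ∑ i ∈ Finset.Iio (⟨k, hk⟩ : Fin n), basisProj v i := by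
      rw [Matrix.mul_sum]
      refine Finset.sum_bij' (fun j hj => ⟨j, (Finset.mem_range.1 hj).trans hk⟩) (fun i _ => i.1)
        ?_ ?_ ?_ ?_ ?_
      · intro j hj; simpa using hj
      · intro i hi; simpa [Fin.lt_def] using hi
      · intro j hj; rfl
      · intro i hi; rfl
      · intro j hj; rw [dif_pos ((Finset.mem_range.1 hj).trans hk)]
    rw [h1, ← Matrix.mul_add]
    have h2 : Finset.Ici (⟨k, hk⟩ : Fin n) = (Finset.Iio (⟨k, hk⟩ : Fin n))ᶜ := by
      ext i; simp
    rw [h2, Finset.sum_add_sum_compl, sum_basisProj, Matrix.mul_one]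
  · have hjn := hj.trans hk
    simp only [dif_pos hjn]
    refine ⟨(rank_mul_le_right _ _).trans (rank_vecMulVec_le _ _), ?_⟩
    have := norm_mul_sum_basisProj_le hσ0 hv (s := {⟨j, hjn⟩})
      ((hσ0 ⟨j, hjn⟩).trans (hστ ⟨j, hjn⟩)) (fun i hi => by
        rw [Finset.mem_singleton.1 hi]; exact hστ ⟨j, hjn⟩)
    rwa [Finset.sum_singleton] at this
  · exact norm_mul_sum_basisProj_le hσ0 hv ((hσ0 ⟨k, hk⟩).trans (hστ ⟨k, hk⟩))
      fun i hi => (hσ (Finset.mem_Ici.1 hi)).trans (hστ ⟨k, hk⟩)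

/-- The Sylvester operator `X ↦ A X - X B`. -/
noncomputable def sylvesterMap (A : Matrix (Fin m) (Fin m) ℂ) (B : Matrix (Fin n) (Fin n) ℂ) :
    Matrix (Fin m) (Fin n) ℂ →ₗ[ℂ] Matrix (Fin m) (Fin n) ℂ where
  toFun X := A * X - X * B
  map_add' X Y := by rw [Matrix.mul_add, Matrix.add_mul]; abel
  map_smul' c X := by
    rw [Matrix.mul_smul, Matrix.smul_mul, RingHom.id_apply, smul_sub]

lemma sylvesterMap_bijective (hA : IsSelfAdjoint A) (hB : IsSelfAdjoint B)
    (ha : 0 < a) (hab : a ≤ b) (hsA : spectrum ℝ A ⊆ Set.Icc (-b) (-a))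
    (hsB : spectrum ℝ B ⊆ Set.Icc a b) : Function.Bijective (sylvesterMap A B) := by
  have hinj : Function.Injective (sylvesterMap A B) := by
    rw [← LinearMap.ker_eq_bot, LinearMap.ker_eq_bot']
    intro X hX
    have h := norm_sylvester_solution_le hA hB ha hab hsA hsB (G := 0) hX
    rw [norm_zero] at h
    exact norm_le_zero_iff.1 (nonpos_of_mul_nonpos_right h (by positivity))
  exact ⟨hinj, LinearMap.injective_iff_surjective.1 hinj⟩

/-- Solutions of Sylvester equations with right-hand side of rank at most one are well approximated
by matrices of low rank. -/
lemma exists_low_rank_approx_of_rank_le_one (hA : IsSelfAdjoint A) (hB : IsSelfAdjoint B)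
    (ha : 0 < a) (hab : a < b) (hsA : spectrum ℝ A ⊆ Set.Icc (-b) (-a))
    (hsB : spectrum ℝ B ⊆ Set.Icc a b) (h : A * X - X * B = G) (hG : G.rank ≤ 1) (l : ℕ) :
    ∃ N : Matrix (Fin m) (Fin n) ℂ, N.rank ≤ l ∧
      ‖X - N‖ ≤ 4 * (Real.exp (Real.pi ^ 2 / Real.log (4 * b / a)) ^ l)⁻¹ * ‖X‖ := by
  obtain ⟨p, hp, hz⟩ := exists_zolotarev_shifts ha hab l
  set r := 2 * Real.exp (-(l * Real.pi ^ 2 / (2 * Real.log (4 * b / a)))) with hr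
  have hr0 : 0 ≤ r := by positivity
  have hr2 : r ^ 2 = 4 * (Real.exp (Real.pi ^ 2 / Real.log (4 * b / a)) ^ l)⁻¹ := by
    rw [hr, mul_pow, ← Real.exp_nat_mul, ← Real.exp_nat_mul, ← Real.exp_neg]
    congr 1
    · norm_num
    · congr 1
      rw [← div_div]
      push_cast
      ring
  refine ⟨_, rank_sub_adi_le hA hB (fun x hx => (hsA hx).2.trans_lt (by linarith))
    (fun x hx => ha.trans_le (hsB hx).1) h hG hp l, ?_⟩
  set C := cfc (fun x : ℝ => ∏ i ∈ Finset.range l, (x + p i) / (x - p i)) A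
  set D := cfc (fun x : ℝ => ∏ i ∈ Finset.range l, (x - p i) / (x + p i)) B
  have hC : ‖C‖ ≤ r := by
    refine norm_cfc_le hr0 fun x hx => ?_
    have hx' : -x ∈ Set.Icc a b := ⟨by linarith [(hsA hx).2], by linarith [(hsA hx).1]⟩
    refine le_trans (le_of_eq ?_) (hz (-x) hx')
    rw [Real.norm_eq_abs]
    congr 1
    refine Finset.prod_congr rfl fun i _ => ?_
    rw [← neg_div_neg_eq]
    congr 1 <;> ring
  have hD : ‖D‖ ≤ r := norm_cfc_le hr0 fun x hx => hz x (hsB hx)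
  rw [sub_sub_cancel, ← hr2]
  calc ‖C * X * D‖ ≤ ‖C * X‖ * ‖D‖ := l2_opNorm_mul _ _
    _ ≤ ‖C‖ * ‖X‖ * ‖D‖ := by gcongr; exact l2_opNorm_mul _ _
    _ ≤ r * ‖X‖ * r := by gcongr
    _ = _ := by ring

/-- Solutions of Sylvester equations with right-hand sides of geometrically decaying singular values
are well approximated by matrices of low rank. -/
lemma exists_low_rank_approx_sylvester (hA : IsSelfAdjoint A) (hB : IsSelfAdjoint B)
    (ha : 0 < a) (hab : a < b) (hsA : spectrum ℝ A ⊆ Set.Icc (-b) (-a))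
    (hsB : spectrum ℝ B ⊆ Set.Icc a b) (h : A * X - X * B = G) {K μ : ℝ}
    (hμ : μ = Real.exp (Real.pi ^ 2 / Real.log (4 * b / a)))
    (hG : ∀ j < n, ∀ r : ℝ,
      (∀ N : Matrix (Fin m) (Fin n) ℂ, N.rank < j + 1 → r ≤ ‖G - N‖) →
        r ≤ K * (μ ^ j)⁻¹ * ‖G‖) (hK : 0 ≤ K) {k : ℕ} (hk : k < n) :
    ∃ N : Matrix (Fin m) (Fin n) ℂ, N.rank ≤ k * (k + 1) / 2 ∧
      ‖X - N‖ ≤ K * b / a * (4 * k + 1) * (μ ^ k)⁻¹ * ‖X‖ := by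
  have hb : 0 < b := ha.trans hab
  have hμ0 : 0 < μ := hμ ▸ Real.exp_pos _
  have hnA : ‖A‖ ≤ b := norm_le_of_spectrum hA hb.le fun x hx =>
    abs_le.2 ⟨(hsA hx).1, by linarith [(hsA hx).2]⟩
  have hnB : ‖B‖ ≤ b := norm_le_of_spectrum hB hb.le fun x hx =>
    abs_le.2 ⟨by linarith [(hsB hx).1], (hsB hx).2⟩
  have hnG : ‖G‖ ≤ 2 * b * ‖X‖ := by
    rw [← h]
    calc ‖A * X - X * B‖ ≤ ‖A * X‖ + ‖X * B‖ := norm_sub_le _ _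
      _ ≤ ‖A‖ * ‖X‖ + ‖X‖ * ‖B‖ := add_le_add (l2_opNorm_mul _ _) (l2_opNorm_mul _ _)
      _ ≤ b * ‖X‖ + ‖X‖ * b := by gcongr
      _ = _ := by ring
  obtain ⟨f, g, hfg, hf, hg⟩ := exists_rank_one_decomposition G hk hG
  obtain ⟨hinj, hsurj⟩ := sylvesterMap_bijective hA hB ha hab.le hsA hsB
  choose Y hY using fun j => hsurj (f j)
  obtain ⟨Z, hZ⟩ := hsurj g
  have hXsum : X = ∑ j ∈ Finset.range k, Y j + Z := by
    apply hinj
    rw [map_add, map_sum, hZ, Finset.sum_congr rfl fun j _ => hY j, ← hfg]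
    exact h
  have hsol {W R : Matrix (Fin m) (Fin n) ℂ} (hW : sylvesterMap A B W = R) {j : ℕ}
      (hR : ‖R‖ ≤ K * (μ ^ j)⁻¹ * ‖G‖) : ‖W‖ ≤ K * b / a * (μ ^ j)⁻¹ * ‖X‖ := by
    have h1 := norm_sylvester_solution_le hA hB ha hab.le hsA hsB hW
    have h2 : K * (μ ^ j)⁻¹ * ‖G‖ ≤ K * (μ ^ j)⁻¹ * (2 * b * ‖X‖) := by gcongr
    refine le_of_mul_le_mul_left (h1.trans (hR.trans (h2.trans_eq ?_)))
      (show 0 < 2 * a by positivity)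
    field_simp
  have happ (j : ℕ) : ∃ N : Matrix (Fin m) (Fin n) ℂ, j < k → N.rank ≤ k - j ∧
      ‖Y j - N‖ ≤ 4 * (K * b / a * (μ ^ k)⁻¹ * ‖X‖) := by
    by_cases hj : j < k
    · obtain ⟨N, hN, hYN⟩ := exists_low_rank_approx_of_rank_le_one hA hB ha hab hsA hsB
        (hY j) (hf j hj).1 (k - j)
      refine ⟨N, fun _ => ⟨hN, hYN.trans ?_⟩⟩
      rw [← hμ]
      have h1 := hsol (hY j) (hf j hj).2
      calc 4 * (μ ^ (k - j))⁻¹ * ‖Y j‖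
          ≤ 4 * (μ ^ (k - j))⁻¹ * (K * b / a * (μ ^ j)⁻¹ * ‖X‖) := by gcongr
        _ = _ := by
          rw [show (μ ^ k)⁻¹ = (μ ^ (k - j))⁻¹ * (μ ^ j)⁻¹ by
            rw [← mul_inv, ← pow_add, Nat.sub_add_cancel hj.le]]
          ring
    · exact ⟨0, fun h => absurd h hj⟩
  choose N hN using happ
  refine ⟨∑ j ∈ Finset.range k, N j, ?_, ?_⟩
  · calc (∑ j ∈ Finset.range k, N j).rank ≤ ∑ j ∈ Finset.range k, (N j).rank := rank_sum_le _ _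
      _ ≤ ∑ j ∈ Finset.range k, (k - j) :=
        Finset.sum_le_sum fun j hj => (hN j (Finset.mem_range.1 hj)).1
      _ = ∑ j ∈ Finset.range k, (j + 1) := by
        rw [← Finset.sum_range_reflect]
        refine Finset.sum_congr rfl fun j hj => ?_
        have := Finset.mem_range.1 hj
        omega
      _ = ∑ j ∈ Finset.range (k + 1), j := by rw [Finset.sum_range_succ', add_zero]
      _ = k * (k + 1) / 2 := by rw [Finset.sum_range_id, Nat.add_sub_cancel, mul_comm]
  · rw [hXsum, add_sub_right_comm, ← Finset.sum_sub_distrib, ← hXsum]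
    calc _ ≤ ∑ j ∈ Finset.range k, ‖Y j - N j‖ + ‖Z‖ :=
          (norm_add_le _ _).trans (add_le_add_left (norm_sum_le _ _) _)
      _ ≤ ∑ _j ∈ Finset.range k, 4 * (K * b / a * (μ ^ k)⁻¹ * ‖X‖) +
          K * b / a * (μ ^ k)⁻¹ * ‖X‖ :=
        add_le_add (Finset.sum_le_sum fun j hj => (hN j (Finset.mem_range.1 hj)).2) (hsol hZ hg)
      _ = _ := by
        rw [Finset.sum_const, Finset.card_range, nsmul_eq_mul]; ring

end Matrix

/-- **Singular value bounds for Sylvester equations with spectra in opposite real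
intervals.**  If `AX - XB = F` with `A, B` normal, `λ(A) ⊆ [-b, -a]`, `λ(B) ⊆ [a, b]`
(`0 < a < b`), `μ₂ = exp(π²/log(4b/a))`, and `σ_{j+1}(F) ≤ K μ₂^{-j} ‖F‖₂` for all
`0 ≤ j < n` with `K ≥ 1`, then for each triangular number `t = k(k+1)/2` with
`1 ≤ t < n`, `σ_{t+1}(X) ≤ (Kb/a)(6√t + 1) μ₂^{-(√(8t+1)-1)/2} ‖X‖₂`. -/
theorem sylvester_singular_values_opposite_intervals {m n : ℕ} (hmn : n ≤ m)
    (a b : ℝ) (ha : 0 < a) (hab : a < b)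
    (μ₂ : ℝ) (hμ : μ₂ = Real.exp (Real.pi ^ 2 / Real.log (4 * b / a)))
    (A : Matrix (Fin m) (Fin m) ℂ) (B : Matrix (Fin n) (Fin n) ℂ)
    (hA : A * A.conjTranspose = A.conjTranspose * A)
    (hB : B * B.conjTranspose = B.conjTranspose * B)
    (hspecA : spectrum ℂ A ⊆ (fun r : ℝ => (r : ℂ)) '' Set.Icc (-b) (-a))
    (hspecB : spectrum ℂ B ⊆ (fun r : ℝ => (r : ℂ)) '' Set.Icc a b)
    (F X : Matrix (Fin m) (Fin n) ℂ) (hX : A * X - X * B = F)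
    (K : ℝ) (hK : 1 ≤ K)
    (hF : ∀ j < n, singularValue F (j + 1) ≤ K * (μ₂ ^ j)⁻¹ * specNorm F)
    (k t : ℕ) (htk : t = k * (k + 1) / 2) (ht1 : 1 ≤ t) (htn : t < n) :
    singularValue X (t + 1) ≤
      K * b / a * (6 * Real.sqrt t + 1) *
        μ₂ ^ (-(Real.sqrt (8 * (t : ℝ) + 1) - 1) / 2) * specNorm X := by
  have hA' := Matrix.isSelfAdjoint_of_spectrum_subset_real hA hspecA
  have hB' := Matrix.isSelfAdjoint_of_spectrum_subset_real hB hspecB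
  have hkt : k ≤ t := by
    rw [htk, Nat.le_div_iff_mul_le two_pos]
    rcases k.eq_zero_or_pos with rfl | hk
    · simp
    · exact Nat.mul_le_mul_left k (by omega)
  have hb : 0 < b := ha.trans hab
  have hμ0 : 0 < μ₂ := hμ ▸ Real.exp_pos _
  obtain ⟨N, hN, hle⟩ := Matrix.exists_low_rank_approx_sylvester hA' hB' ha hab
    (Matrix.real_spectrum_subset hspecA) (Matrix.real_spectrum_subset hspecB) hX hμ
    (fun j hj r hr => le_trans (le_csInf (.image _ ⟨0, by simp⟩) (by
      rintro _ ⟨N, hN, rfl⟩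
      exact hr N hN)) (hF j hj)) (zero_le_one.trans hK) (hkt.trans_lt htn)
  have hσ : singularValue X (t + 1) ≤ specNorm (X - N) :=
    csInf_le ⟨0, by rintro _ ⟨M, -, rfl⟩; exact norm_nonneg _⟩
      ⟨N, Nat.lt_succ_of_le (htk ▸ hN), rfl⟩
  have h2t : 2 * (t : ℝ) = k * (k + 1) := by
    have : 2 * t = k * (k + 1) := by
      rw [htk, Nat.mul_div_cancel' (Nat.even_mul_succ_self k).two_dvd]
    exact_mod_cast this
  have hk1 : (1 : ℝ) ≤ k := by
    have : k ≠ 0 := by rintro rfl; simp at htk; omega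
    exact_mod_cast Nat.one_le_iff_ne_zero.2 this
  have hroot : -(Real.sqrt (8 * (t : ℝ) + 1) - 1) / 2 = -(k : ℝ) := by
    rw [show 8 * (t : ℝ) + 1 = (2 * k + 1) ^ 2 by linear_combination 4 * h2t,
      Real.sqrt_sq (by positivity)]
    ring
  have hsqrt : 4 * (k : ℝ) ≤ 6 * Real.sqrt t := by
    have : Real.sqrt t ^ 2 = t := Real.sq_sqrt (Nat.cast_nonneg t)
    refine (sq_le_sq₀ (by positivity) (by positivity)).1 ?_
    nlinarith
  rw [hroot, Real.rpow_neg hμ0.le, Real.rpow_natCast]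
  have hX0 : 0 ≤ specNorm X := norm_nonneg _
  calc singularValue X (t + 1) ≤ K * b / a * (4 * k + 1) * (μ₂ ^ k)⁻¹ * specNorm X :=
        hσ.trans hle
    _ ≤ _ := by gcongr
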